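/- Let λ = (2,0,0) and let T₁, T₂, T₃ ∈ ℝ. Then there exist x₁,x₂,x₃ > 0 and c > 0 such that R_i(λ,x) = c·T_i for i = 1,2,3 if and only if T₁ > 0, T₂ < 0 and T₃ < 0. Moreover, if (x,c) and (x′,c′) are two such solutions, then c = c′ and x′ = t·x for some t > 0. -/

import Mathlib

open scoped BigOperators

/-- The diagonal components of the Ricci curvature of the left-invariant metric
`g(V_i,V_j) = δ_{ij} x_i` in a Milnor frame with structure constants `lam`:
`R_i(λ,x) = x_i (λ_i² x_i² − (λ_j x_j − λ_k x_k)²) / (2 x₁ x₂ x₃)`, where `(i,j,k)`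
is the cyclic permutation of `(1,2,3)` starting at `i`. -/
noncomputable def ricMilnor (lam x : Fin 3 → ℝ) (i : Fin 3) : ℝ :=
  x i * ((lam i) ^ 2 * (x i) ^ 2 - (lam (i + 1) * x (i + 1) - lam (i + 2) * x (i + 2)) ^ 2)
    / (2 * x 0 * x 1 * x 2)

theorem ric_iff (T₁ T₂ T₃ : ℝ) (x : Fin 3 → ℝ) (c : ℝ) (hx : ∀ i, 0 < x i) :
    (∀ i, ricMilnor ![2, 0, 0] x i = c * ![T₁, T₂, T₃] i) ↔
      (2 * x 0 ^ 2 = c * T₁ * (x 1 * x 2) ∧ -2 * x 0 = c * T₂ * x 2 ∧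
        -2 * x 0 = c * T₃ * x 1) := by
  have h0 := hx 0
  have h1 := hx 1
  have h2 := hx 2
  have e1 : ricMilnor ![2, 0, 0] x 0 = 2 * x 0 ^ 2 / (x 1 * x 2) := by
    simp [ricMilnor]
    field_simp
  have e2 : ricMilnor ![2, 0, 0] x 1 = -2 * x 0 / x 2 := by
    have a1 : (1 + 1 : Fin 3) = 2 := rfl
    have a2 : (1 + 2 : Fin 3) = 0 := rfl
    simp [ricMilnor, a1, a2]
    field_simp
  have e3 : ricMilnor ![2, 0, 0] x 2 = -2 * x 0 / x 1 := by
    have a1 : (2 + 1 : Fin 3) = 0 := rfl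
    have a2 : (2 + 2 : Fin 3) = 1 := rfl
    simp [ricMilnor, a1, a2]
    field_simp
  rw [Fin.forall_fin_succ, Fin.forall_fin_two]
  change (ricMilnor ![2, 0, 0] x 0 = c * T₁ ∧ ricMilnor ![2, 0, 0] x 1 = c * T₂ ∧
    ricMilnor ![2, 0, 0] x 2 = c * T₃) ↔ _
  rw [e1, e2, e3, div_eq_iff (by positivity), div_eq_iff (by positivity),
    div_eq_iff (by positivity)]

theorem c_eq (T₁ T₂ T₃ a b d c : ℝ) (hb : 0 < b) (hd : 0 < d) (hc : 0 < c)
    (h1 : 2 * a ^ 2 = c * T₁ * (b * d)) (h2 : -2 * a = c * T₂ * d)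
    (h3 : -2 * a = c * T₃ * b) : c * (T₂ * T₃) = 2 * T₁ := by
  have : c * (b * d) ≠ 0 := by positivity
  apply mul_left_cancel₀ this
  linear_combination 2 * h1 + 2 * a * h2 - c * T₂ * d * h3

theorem stmt17 (T₁ T₂ T₃ : ℝ) :
    ((∃ (x : Fin 3 → ℝ) (c : ℝ), (∀ i, 0 < x i) ∧ 0 < c ∧ (∀ i, ricMilnor ![2, 0, 0] x i = c * ![T₁, T₂, T₃] i)) ↔ (0 < T₁ ∧ T₂ < 0 ∧ T₃ < 0)) ∧
    (∀ (x x' : Fin 3 → ℝ) (c c' : ℝ),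
      (∀ i, 0 < x i) → 0 < c → (∀ i, ricMilnor ![2, 0, 0] x i = c * ![T₁, T₂, T₃] i) →
      (∀ i, 0 < x' i) → 0 < c' → (∀ i, ricMilnor ![2, 0, 0] x' i = c' * ![T₁, T₂, T₃] i) →
      c = c' ∧ (∃ t : ℝ, 0 < t ∧ ∀ i, x' i = t * x i)) := by
  have key : ∀ (x : Fin 3 → ℝ) (c : ℝ), (∀ i, 0 < x i) → 0 < c →
      (∀ i, ricMilnor ![2, 0, 0] x i = c * ![T₁, T₂, T₃] i) → (0 < T₁ ∧ T₂ < 0 ∧ T₃ < 0) := by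
    intro x c hx hc h
    rw [ric_iff _ _ _ _ _ hx] at h
    obtain ⟨p1, p2, p3⟩ := h
    have h0 := hx 0
    have h1 := hx 1
    have h2 := hx 2
    refine ⟨?_, ?_, ?_⟩
    · by_contra! hn
      have : 0 ≤ c * (-T₁) * (x 1 * x 2) := by
        have : 0 ≤ -T₁ := by linarith
        positivity
      nlinarith [pow_pos h0 2]
    · by_contra! hn
      have : 0 ≤ c * T₂ * x 2 := by positivity
      linarith
    · by_contra! hn
      have : 0 ≤ c * T₃ * x 1 := by positivity
      linarith
  refine ⟨⟨?_, ?_⟩, ?_⟩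
  · rintro ⟨x, c, hx, hc, h⟩
    exact key x c hx hc h
  · rintro ⟨t1, t2, t3⟩
    have hx : ∀ i, 0 < (![T₁, -T₂, -T₃] : Fin 3 → ℝ) i := by
      intro i
      fin_cases i <;> simp <;> assumption
    have hp : 0 < T₂ * T₃ := mul_pos_of_neg_of_neg t2 t3
    have n2 := t2.ne
    have n3 := t3.ne
    refine ⟨![T₁, -T₂, -T₃], 2 * T₁ / (T₂ * T₃), hx, by positivity, ?_⟩
    rw [ric_iff _ _ _ _ _ hx]
    change 2 * T₁ ^ 2 = 2 * T₁ / (T₂ * T₃) * T₁ * (-T₂ * -T₃) ∧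
      -2 * T₁ = 2 * T₁ / (T₂ * T₃) * T₂ * -T₃ ∧ -2 * T₁ = 2 * T₁ / (T₂ * T₃) * T₃ * -T₂
    refine ⟨?_, ?_, ?_⟩ <;> field_simp
  · intro x x' c c' hx hc h hx' hc' h'
    obtain ⟨t1, t2, t3⟩ := key x c hx hc h
    rw [ric_iff _ _ _ _ _ hx] at h
    rw [ric_iff _ _ _ _ _ hx'] at h'
    obtain ⟨p1, p2, p3⟩ := h
    obtain ⟨q1, q2, q3⟩ := h'
    have hp : 0 < T₂ * T₃ := mul_pos_of_neg_of_neg t2 t3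
    have e := c_eq _ _ _ _ _ _ _ (hx 1) (hx 2) hc p1 p2 p3
    have e' := c_eq _ _ _ _ _ _ _ (hx' 1) (hx' 2) hc' q1 q2 q3
    have hcc : c = c' := mul_right_cancel₀ hp.ne' (e.trans e'.symm)
    subst hcc
    have h0 := hx 0
    have h0' := hx' 0
    refine ⟨rfl, x' 0 / x 0, by positivity, ?_⟩
    rw [Fin.forall_fin_succ, Fin.forall_fin_two]
    change x' 0 = x' 0 / x 0 * x 0 ∧ x' 1 = x' 0 / x 0 * x 1 ∧ x' 2 = x' 0 / x 0 * x 2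
    have n2 : c * T₂ ≠ 0 := mul_ne_zero hc.ne' t2.ne
    have n3 : c * T₃ ≠ 0 := mul_ne_zero hc.ne' t3.ne
    refine ⟨by field_simp, ?_, ?_⟩
    · rw [div_mul_eq_mul_div, eq_div_iff h0.ne']
      apply mul_left_cancel₀ n3
      linear_combination x' 0 * p3 - x 0 * q3
    · rw [div_mul_eq_mul_div, eq_div_iff h0.ne']
      apply mul_left_cancel₀ n2
      linear_combination x' 0 * p2 - x 0 * q2
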